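/- arXiv:2605.23601 — 20 statements merged into one kernel-verified Lean document; each statement's English description precedes it below -/
import Mathlib

section
/- Let m be a positive integer such that n = 24m+1 is prime, and let (n1, n2, n3) be a tame solution of the Erdős–Straus equation for n, i.e. positive integers with n1 ≤ n2, n1 ≤ n3, 4/n = 1/n1 + 1/n2 + 1/n3, and such that n2 and n3 both divide n1·n. Then there exists an integer k with 1 ≤ k ≤ 12m and n1 = 6m+k, and the numerator summands ℑ1 = n1·n/n2 and ℑ2 = n1·n/n3 are positive integers satisfying ℑ1 + ℑ2 = 4k−1, ℑ1 | (6m+k) and ℑ2 | (6m+k). -/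
/-- For a prime `n ≡ 1 [MOD 4]`, if `4 * x = n + a + b` where `a, b ≤ n` divide `x * n`,
then `n` does not divide `a`. -/
lemma not_prime_dvd_of_four_mul_eq {n x a b : ℕ} (hp : n.Prime) (hn : n % 4 = 1)
    (ha : 0 < a) (hb : 0 < b) (han : a ≤ n) (hbn : b ≤ n) (hdb : b ∣ x * n)
    (h : 4 * x = n + a + b) : ¬ n ∣ a := by
  intro hna
  obtain rfl : a = n := le_antisymm han (Nat.le_of_dvd ha hna)
  have hab : ¬ a ∣ b := fun hab => by
    have := Nat.le_of_dvd hb hab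
    omega
  have hbx : b ∣ x := (((hp.coprime_iff_not_dvd).2 hab).symm).dvd_of_dvd_mul_right hdb
  obtain ⟨c, rfl⟩ := hbx
  obtain _ | d := c
  · omega
  have hmul : (4 * d + 3) * b = a * 2 := by linarith
  have hcop : Nat.Coprime (4 * d + 3) 2 := by
    rw [Nat.coprime_two_right, Nat.odd_iff]
    omega
  have hdvd : 4 * d + 3 ∣ a := hcop.dvd_of_dvd_mul_right ⟨b, hmul.symm⟩
  rcases (Nat.dvd_prime hp).1 hdvd with h1 | h1 <;> omega

/-- For a prime `n = 24m+1`, a tame solution `(n1, n2, n3)` of the Erdős–Straus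
equation (i.e. `4/n = 1/n1 + 1/n2 + 1/n3` with `n1 ≤ n2`, `n1 ≤ n3` and
`n2 ∣ n1*n`, `n3 ∣ n1*n`) satisfies: `n1 = 6m+k` for some `1 ≤ k ≤ 12m`, and the
numerator summands `ℑ1 = n1*n/n2`, `ℑ2 = n1*n/n3` are positive, sum to `4k-1`,
and both divide `6m+k`. -/
theorem tame_solution_structure (m n n1 n2 n3 : ℕ)
    (hm : 0 < m) (hn : n = 24 * m + 1) (hp : Nat.Prime n)
    (h1 : 0 < n1) (h2 : 0 < n2) (h3 : 0 < n3)
    (h12 : n1 ≤ n2) (h13 : n1 ≤ n3)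
    (heq : (4 : ℚ) / n = 1 / n1 + 1 / n2 + 1 / n3)
    (hd2 : n2 ∣ n1 * n) (hd3 : n3 ∣ n1 * n) :
    ∃ k : ℕ, 1 ≤ k ∧ k ≤ 12 * m ∧ n1 = 6 * m + k ∧
      0 < n1 * n / n2 ∧ 0 < n1 * n / n3 ∧
      n1 * n / n2 + n1 * n / n3 = 4 * k - 1 ∧
      (n1 * n / n2) ∣ (6 * m + k) ∧ (n1 * n / n3) ∣ (6 * m + k) := by
  obtain ⟨a, ha⟩ := hd2
  obtain ⟨b, hb⟩ := hd3
  have hn0 : 0 < n := hp.pos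
  have hqa : n1 * n / n2 = a := by rw [ha, Nat.mul_div_cancel_left _ h2]
  have hqb : n1 * n / n3 = b := by rw [hb, Nat.mul_div_cancel_left _ h3]
  rw [hqa, hqb]
  have ha0 : 0 < a := Nat.pos_of_mul_pos_left (ha ▸ Nat.mul_pos h1 hn0)
  have hb0 : 0 < b := Nat.pos_of_mul_pos_left (hb ▸ Nat.mul_pos h1 hn0)
  have han : a ≤ n := by
    refine Nat.le_of_mul_le_mul_left ?_ h1
    rw [ha]
    exact Nat.mul_le_mul_right a h12
  have hbn : b ≤ n := by
    refine Nat.le_of_mul_le_mul_left ?_ h1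
    rw [hb]
    exact Nat.mul_le_mul_right b h13
  have hsum : 4 * n1 = n + a + b := by
    have hnQ : (n : ℚ) ≠ 0 := by positivity
    have h1Q : (n1 : ℚ) ≠ 0 := by positivity
    have h2Q : (n2 : ℚ) ≠ 0 := by positivity
    have h3Q : (n3 : ℚ) ≠ 0 := by positivity
    have haQ : (n1 : ℚ) * n = n2 * a := by exact_mod_cast ha
    have hbQ : (n1 : ℚ) * n = n3 * b := by exact_mod_cast hb
    have e2 : (a : ℚ) = n1 * n * (1 / n2) := by
      rw [haQ]
      field_simp
    have e3 : (b : ℚ) = n1 * n * (1 / n3) := by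
      rw [hbQ]
      field_simp
    have key : (4 : ℚ) * n1 = n + a + b := by
      calc (4 : ℚ) * n1 = n1 * n * (4 / n) := by field_simp
        _ = n1 * n * (1 / n1) + n1 * n * (1 / n2) + n1 * n * (1 / n3) := by rw [heq]; ring
        _ = n + a + b := by rw [← e2, ← e3]; field_simp
    exact_mod_cast key
  have hmod : n % 4 = 1 := by omega
  have hda : a ∣ n1 * n := ⟨n2, by rw [ha, mul_comm]⟩
  have hdb : b ∣ n1 * n := ⟨n3, by rw [hb, mul_comm]⟩
  have hna := not_prime_dvd_of_four_mul_eq hp hmod ha0 hb0 han hbn hdb hsum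
  have hnb := not_prime_dvd_of_four_mul_eq hp hmod hb0 ha0 hbn han hda (by omega)
  have hax : a ∣ n1 := ((hp.coprime_iff_not_dvd).2 hna).symm.dvd_of_dvd_mul_right hda
  have hbx : b ∣ n1 := ((hp.coprime_iff_not_dvd).2 hnb).symm.dvd_of_dvd_mul_right hdb
  have hk : 6 * m + (n1 - 6 * m) = n1 := by omega
  refine ⟨n1 - 6 * m, by omega, by omega, hk.symm, ha0, hb0, by omega, ?_, ?_⟩
  · rwa [hk]
  · rwa [hk]
end

section
/- Let m and k be positive integers, and let ℑ1, ℑ2 be positive integers with ℑ1 + ℑ2 = 4k−1 such that ℑ1 and ℑ2 both divide (6m+k)(24m+1). Set ℑ = lcm(ℑ1, ℑ2). Then for every integer c such that m + cℑ ≥ 1, the integers ℑ1 and ℑ2 both divide (6(m+cℑ)+k)(24(m+cℑ)+1), and 4/(24(m+cℑ)+1) = 1/(6(m+cℑ)+k) + ℑ1/((6(m+cℑ)+k)(24(m+cℑ)+1)) + ℑ2/((6(m+cℑ)+k)(24(m+cℑ)+1)); in particular the Erdős–Straus equation 4/n = 1/n1 + 1/n2 + 1/n3 has a solution in positive integers for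 n = 24(m+cℑ)+1. -/
theorem dvd_shifted_product {d L m M c k : ℤ} (hdL : d ∣ L) (hM : M = m + c * L)
    (h : d ∣ (6 * m + k) * (24 * m + 1)) : d ∣ (6 * M + k) * (24 * M + 1) := by
  have hmod : M ≡ m [ZMOD d] :=
    (Int.modEq_iff_dvd.2 (by rw [hM, add_sub_cancel_left]; exact hdL.mul_left c)).symm
  have hprod : (6 * M + k) * (24 * M + 1) ≡ (6 * m + k) * (24 * m + 1) [ZMOD d] := by
    gcongr
  exact hprod.dvd_iff.2 h

theorem exists_unit_fraction_of_dvd {d : ℕ} {N : ℤ} (hd : 0 < d) (hN : 0 < N)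
    (h : (d : ℤ) ∣ N) : ∃ n : ℕ, 0 < n ∧ (d : ℚ) / N = 1 / n := by
  lift N to ℕ using hN.le
  obtain ⟨n, rfl⟩ := Int.natCast_dvd_natCast.1 h
  refine ⟨n, Nat.pos_of_mul_pos_left (by exact_mod_cast hN), ?_⟩
  have : (d : ℚ) ≠ 0 := by positivity
  push_cast
  rw [div_mul_eq_div_div, div_self this]


/-- If `ℑ1 + ℑ2 = 4k-1` and both `ℑ1, ℑ2` divide `(6m+k)(24m+1)`, then with
`ℑ = lcm(ℑ1, ℑ2)`, for every integer `c` with `M = m + cℑ ≥ 1`, both `ℑ1` and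
`ℑ2` divide `(6M+k)(24M+1)`, the corresponding Erdős–Straus identity holds,
and in particular the Erdős–Straus equation for `n = 24M+1` has a solution in
positive integers. -/
theorem tame_solution_shift (m k I1 I2 : ℕ)
    (hm : 0 < m) (hk : 0 < k) (hI1 : 0 < I1) (hI2 : 0 < I2)
    (hsum : I1 + I2 = 4 * k - 1)
    (hd1 : I1 ∣ (6 * m + k) * (24 * m + 1))
    (hd2 : I2 ∣ (6 * m + k) * (24 * m + 1))
    (c : ℤ) (M : ℤ) (hM : M = (m : ℤ) + c * (Nat.lcm I1 I2 : ℤ)) (hM1 : 1 ≤ M) :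
    (I1 : ℤ) ∣ (6 * M + k) * (24 * M + 1) ∧
    (I2 : ℤ) ∣ (6 * M + k) * (24 * M + 1) ∧
    (4 : ℚ) / (24 * (M : ℚ) + 1) =
      1 / (6 * (M : ℚ) + k)
      + (I1 : ℚ) / ((6 * (M : ℚ) + k) * (24 * (M : ℚ) + 1))
      + (I2 : ℚ) / ((6 * (M : ℚ) + k) * (24 * (M : ℚ) + 1)) ∧
    ∃ n1 n2 n3 : ℕ, 0 < n1 ∧ 0 < n2 ∧ 0 < n3 ∧
      (4 : ℚ) / (24 * (M : ℚ) + 1) = 1 / n1 + 1 / n2 + 1 / n3 := by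
  have h1 : (I1 : ℤ) ∣ (6 * M + k) * (24 * M + 1) :=
    dvd_shifted_product (mod_cast Nat.dvd_lcm_left I1 I2) hM (mod_cast hd1)
  have h2 : (I2 : ℤ) ∣ (6 * M + k) * (24 * M + 1) :=
    dvd_shifted_product (mod_cast Nat.dvd_lcm_right I1 I2) hM (mod_cast hd2)
  have hMq : (0 : ℚ) < M := by exact_mod_cast hM1
  have hidentity : (4 : ℚ) / (24 * (M : ℚ) + 1) =
      1 / (6 * (M : ℚ) + k)
      + (I1 : ℚ) / ((6 * (M : ℚ) + k) * (24 * (M : ℚ) + 1))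
      + (I2 : ℚ) / ((6 * (M : ℚ) + k) * (24 * (M : ℚ) + 1)) := by
    have hsum' : (I1 : ℚ) + I2 + 1 = 4 * k := by
      exact_mod_cast (by omega : I1 + I2 + 1 = 4 * k)
    field_simp
    linear_combination -hsum'
  have hN : 0 < (6 * M + k) * (24 * M + 1) := by positivity
  obtain ⟨n2, hn2, e2⟩ := exists_unit_fraction_of_dvd hI1 hN h1
  obtain ⟨n3, hn3, e3⟩ := exists_unit_fraction_of_dvd hI2 hN h2
  obtain ⟨n1, hn1⟩ := Int.eq_ofNat_of_zero_le (by positivity : 0 ≤ 6 * M + (k : ℤ))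
  have hn1q : 6 * (M : ℚ) + k = n1 := by exact_mod_cast hn1
  push_cast at e2 e3
  refine ⟨h1, h2, hidentity, n1, n2, n3, by omega, hn2, hn3, ?_⟩
  rw [hidentity, e2, e3, hn1q]
end

section
/- For all r, c ∈ ℕ: (a) if m = 7r+4+c(12r+7), then 4/(24m+1) = 1/(2(3c+2)(12r+7)) + 1/((3c+2)(24m+1)) + 1/(2(3c+2)(12r+7)(24m+1)); (b) if m = 11r+10+c(12r+11), then 4/(24m+1) = 1/(6(c+1)(12r+11)) + 1/(3(c+1)(24m+1)) + 1/(6(c+1)(12r+11)(24m+1)). In both cases this gives a solution in positive integers of the Erdős–Straus equation for n = 24m+1. -/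
/-- If `4 * (2 * a * b) = n + 2 * b + 1`, then `4 / n` splits into three unit fractions with
denominators `2 * a * b`, `a * n` and `2 * a * b * n`. -/
theorem four_div_eq_of_four_mul_eq {K : Type*} [Field K] [NeZero (2 : K)] {a b n : K}
    (ha : a ≠ 0) (hb : b ≠ 0) (hn : n ≠ 0) (h : 4 * (2 * a * b) = n + 2 * b + 1) :
    4 / n = 1 / (2 * a * b) + 1 / (a * n) + 1 / (2 * a * b * n) := by
  have h2 : (2 : K) ≠ 0 := two_ne_zero
  field_simp
  linear_combination h

theorem erdos_straus_case_I2_eq_1 (r c m : ℕ) :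
    (m = 7 * r + 4 + c * (12 * r + 7) →
      (4 : ℚ) / (24 * m + 1) =
        1 / (2 * (3 * c + 2) * (12 * r + 7))
        + 1 / ((3 * c + 2) * (24 * (m : ℚ) + 1))
        + 1 / (2 * (3 * c + 2) * (12 * r + 7) * (24 * (m : ℚ) + 1)) ∧
      ∃ n1 n2 n3 : ℕ, 0 < n1 ∧ 0 < n2 ∧ 0 < n3 ∧
        (4 : ℚ) / (24 * m + 1) = 1 / n1 + 1 / n2 + 1 / n3) ∧
    (m = 11 * r + 10 + c * (12 * r + 11) →
      (4 : ℚ) / (24 * m + 1) =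
        1 / (6 * (c + 1) * (12 * r + 11))
        + 1 / (3 * (c + 1) * (24 * (m : ℚ) + 1))
        + 1 / (6 * (c + 1) * (12 * r + 11) * (24 * (m : ℚ) + 1)) ∧
      ∃ n1 n2 n3 : ℕ, 0 < n1 ∧ 0 < n2 ∧ 0 < n3 ∧
        (4 : ℚ) / (24 * m + 1) = 1 / n1 + 1 / n2 + 1 / n3) := by
  constructor
  · rintro rfl
    have key := four_div_eq_of_four_mul_eq (K := ℚ) (a := 3 * c + 2) (b := 12 * r + 7)
      (n := 24 * (7 * r + 4 + c * (12 * r + 7) : ℕ) + 1) (by positivity) (by positivity)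
      (by positivity) (by push_cast; ring)
    refine ⟨key, 2 * (3 * c + 2) * (12 * r + 7),
      (3 * c + 2) * (24 * (7 * r + 4 + c * (12 * r + 7)) + 1),
      2 * (3 * c + 2) * (12 * r + 7) * (24 * (7 * r + 4 + c * (12 * r + 7)) + 1),
      by positivity, by positivity, by positivity, ?_⟩
    exact_mod_cast key
  · rintro rfl
    have key := four_div_eq_of_four_mul_eq (K := ℚ) (a := 3 * (c + 1)) (b := 12 * r + 11)
      (n := 24 * (11 * r + 10 + c * (12 * r + 11) : ℕ) + 1) (by positivity) (by positivity)
      (by positivity) (by push_cast; ring)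
    rw [show (2 : ℚ) * (3 * (c + 1)) = 6 * (c + 1) by ring] at key
    refine ⟨key, 6 * (c + 1) * (12 * r + 11),
      3 * (c + 1) * (24 * (11 * r + 10 + c * (12 * r + 11)) + 1),
      6 * (c + 1) * (12 * r + 11) * (24 * (11 * r + 10 + c * (12 * r + 11)) + 1),
      by positivity, by positivity, by positivity, ?_⟩
    exact_mod_cast key
end

section
/- For all s, t, c ∈ ℕ: (a) if m = 5s+3+c(8s+5), then 4/(24m+1) = 1/(2(3c+2)(8s+5)) + 1/(2(3c+2)(24m+1)) + 1/((3c+2)(8s+5)(24m+1)); (b) if m = 7t+6+c(8t+7), then 4/(24m+1) = 1/(6(c+1)(8t+7)) + 1/(2(c+1)(24m+1)) + 1/(3(c+1)(8t+7)(24m+1)). In both cases this gives a solution in positive integers of the Erdős–Straus equation for n = 24m+1. -/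
theorem erdos_straus_case_I2_eq_2 (s t c m : ℕ) :
    (m = 5 * s + 3 + c * (8 * s + 5) →
      (4 : ℚ) / (24 * m + 1) =
        1 / (2 * (3 * c + 2) * (8 * s + 5))
        + 1 / (2 * (3 * c + 2) * (24 * (m : ℚ) + 1))
        + 1 / ((3 * c + 2) * (8 * s + 5) * (24 * (m : ℚ) + 1)) ∧
      ∃ n1 n2 n3 : ℕ, 0 < n1 ∧ 0 < n2 ∧ 0 < n3 ∧
        (4 : ℚ) / (24 * m + 1) = 1 / n1 + 1 / n2 + 1 / n3) ∧
    (m = 7 * t + 6 + c * (8 * t + 7) →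
      (4 : ℚ) / (24 * m + 1) =
        1 / (6 * (c + 1) * (8 * t + 7))
        + 1 / (2 * (c + 1) * (24 * (m : ℚ) + 1))
        + 1 / (3 * (c + 1) * (8 * t + 7) * (24 * (m : ℚ) + 1)) ∧
      ∃ n1 n2 n3 : ℕ, 0 < n1 ∧ 0 < n2 ∧ 0 < n3 ∧
        (4 : ℚ) / (24 * m + 1) = 1 / n1 + 1 / n2 + 1 / n3) := by
  constructor
  · intro hm
    have hN : (24 * (m : ℚ) + 1) = 24 * (5 * s + 3 + c * (8 * s + 5)) + 1 := by
      rw [hm]; push_cast; ring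
    have key : (4 : ℚ) / (24 * m + 1) =
        1 / (2 * (3 * c + 2) * (8 * s + 5))
        + 1 / (2 * (3 * c + 2) * (24 * (m : ℚ) + 1))
        + 1 / ((3 * c + 2) * (8 * s + 5) * (24 * (m : ℚ) + 1)) := by
      rw [hN]
      field_simp
      ring
    refine ⟨key, 2 * (3 * c + 2) * (8 * s + 5), 2 * (3 * c + 2) * (24 * m + 1),
      (3 * c + 2) * (8 * s + 5) * (24 * m + 1), by positivity, by positivity, by positivity, ?_⟩
    push_cast
    exact key
  · intro hm
    have hN : (24 * (m : ℚ) + 1) = 24 * (7 * t + 6 + c * (8 * t + 7)) + 1 := by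
      rw [hm]; push_cast; ring
    have key : (4 : ℚ) / (24 * m + 1) =
        1 / (6 * (c + 1) * (8 * t + 7))
        + 1 / (2 * (c + 1) * (24 * (m : ℚ) + 1))
        + 1 / (3 * (c + 1) * (8 * t + 7) * (24 * (m : ℚ) + 1)) := by
      rw [hN]
      field_simp
      ring
    refine ⟨key, 6 * (c + 1) * (8 * t + 7), 2 * (c + 1) * (24 * m + 1),
      3 * (c + 1) * (8 * t + 7) * (24 * m + 1), by positivity, by positivity, by positivity, ?_⟩
    push_cast
    exact key
end

section
/- For all t, c ∈ ℕ: (a) if m = 22t+9+2c(12t+5), then 4/(24m+1) = 1/(12(c+1)(12t+5)) + 1/(3(c+1)(24m+1)) + 1/(4(c+1)(12t+5)(24m+1)); (b) if m = 22t+20+2c(12t+11), then 4/(24m+1) = 1/(12(c+1)(12t+11)) + 1/(3(c+1)(24m+1)) + 1/(4(c+1)(12t+11)(24m+1)). In both cases this gives a solution in positive integers of the Erdős–Straus equation for n = 24m+1. -/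
theorem four_div_eq_sum_unit_fractions {c k n : ℚ} (hc : c + 1 ≠ 0) (hk : k ≠ 0) (hn : n ≠ 0)
    (h : n + 4 * k + 3 = 48 * (c + 1) * k) :
    4 / n = 1 / (12 * (c + 1) * k) + 1 / (3 * (c + 1) * n) + 1 / (4 * (c + 1) * k * n) := by
  have hsum : 1 / (12 * (c + 1) * k) + 1 / (3 * (c + 1) * n) + 1 / (4 * (c + 1) * k * n) =
      (n + 4 * k + 3) / (12 * (c + 1) * k * n) := by
    field_simp
    ring
  rw [hsum, h]
  field_simp
  norm_num

theorem exists_unit_fractions_of_eq {c k m : ℕ} (hk : 0 < k)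
    (h : (4 : ℚ) / (24 * m + 1) =
      1 / (12 * (c + 1) * k) + 1 / (3 * (c + 1) * (24 * (m : ℚ) + 1))
        + 1 / (4 * (c + 1) * k * (24 * (m : ℚ) + 1))) :
    ∃ n1 n2 n3 : ℕ, 0 < n1 ∧ 0 < n2 ∧ 0 < n3 ∧
      (4 : ℚ) / (24 * m + 1) = 1 / n1 + 1 / n2 + 1 / n3 :=
  ⟨12 * (c + 1) * k, 3 * (c + 1) * (24 * m + 1), 4 * (c + 1) * k * (24 * m + 1),
    by positivity, by positivity, by positivity, by push_cast; exact h⟩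

theorem erdos_straus_case_I2_eq_3 (t c m : ℕ) :
    (m = 22 * t + 9 + 2 * c * (12 * t + 5) →
      (4 : ℚ) / (24 * m + 1) =
        1 / (12 * (c + 1) * (12 * t + 5))
        + 1 / (3 * (c + 1) * (24 * (m : ℚ) + 1))
        + 1 / (4 * (c + 1) * (12 * t + 5) * (24 * (m : ℚ) + 1)) ∧
      ∃ n1 n2 n3 : ℕ, 0 < n1 ∧ 0 < n2 ∧ 0 < n3 ∧
        (4 : ℚ) / (24 * m + 1) = 1 / n1 + 1 / n2 + 1 / n3) ∧
    (m = 22 * t + 20 + 2 * c * (12 * t + 11) →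
      (4 : ℚ) / (24 * m + 1) =
        1 / (12 * (c + 1) * (12 * t + 11))
        + 1 / (3 * (c + 1) * (24 * (m : ℚ) + 1))
        + 1 / (4 * (c + 1) * (12 * t + 11) * (24 * (m : ℚ) + 1)) ∧
      ∃ n1 n2 n3 : ℕ, 0 < n1 ∧ 0 < n2 ∧ 0 < n3 ∧
        (4 : ℚ) / (24 * m + 1) = 1 / n1 + 1 / n2 + 1 / n3) := by
  constructor
  · intro hm
    have h := four_div_eq_sum_unit_fractions (c := c) (k := 12 * t + 5) (n := 24 * m + 1)
      (by positivity) (by positivity) (by positivity) (by rw [hm]; push_cast; ring)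
    exact ⟨h, exists_unit_fractions_of_eq (k := 12 * t + 5) (by positivity)
      (by push_cast; exact h)⟩
  · intro hm
    have h := four_div_eq_sum_unit_fractions (c := c) (k := 12 * t + 11) (n := 24 * m + 1)
      (by positivity) (by positivity) (by positivity) (by rw [hm]; push_cast; ring)
    exact ⟨h, exists_unit_fractions_of_eq (k := 12 * t + 11) (by positivity)
      (by push_cast; exact h)⟩
end

section
/- For all r, t, c ∈ ℕ: (a) if m = 62r+14+2c(48r+11), then 4/(24m+1) = 1/(4(3c+2)(48r+11)) + 1/(4(3c+2)(24m+1)) + 1/((3c+2)(48r+11)(24m+1)); (b) if m = 94r+84+2c(48r+43), then 4/(24m+1) = 1/(12(c+1)(48r+43)) + 1/(12(c+1)(24m+1)) + 1/(3(c+1)(48r+43)(24m+1)); (c) if m = 94t+37+2c(48t+19), then 4/(24m+1) = 1/(12(c+1)(48t+19)) + 1/(12(c+1)(24m+1)) + 1/(3(c+1)(48t+19)(24m+1)); (d) if m = 62t+45+2c(48t+35), then 4/(24m+1) = 1/(4(3c+2)(48t+35)) + 1/(4(3c+2)(24m+1)) + 1/((3c+2)(48t+35)(24m+1)). In all cases this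 gives a solution in positive integers of the Erdős–Straus equation for n = 24m+1. -/
/-- If `n + q + 4 = 16 * A * q`, then `4 / n` is the sum of the reciprocals of `4 * A * q`,
`4 * A * n` and `A * q * n`. -/
theorem four_div_eq_of_add_add_four_eq {K : Type*} [Field K] [CharZero K] {A q n : K}
    (hA : A ≠ 0) (hq : q ≠ 0) (hn : n ≠ 0) (h : n + q + 4 = 16 * A * q) :
    4 / n = 1 / (4 * A * q) + 1 / (4 * A * n) + 1 / (A * q * n) := by
  field_simp
  linear_combination -h

/-- The Erdős–Straus equation is solvable for `n` whenever `n + q + 4 = 16 * A * q`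
with `A`, `q`, `n` positive. -/
theorem exists_erdos_straus_of_add_add_four_eq {A q n : ℕ}
    (hA : 0 < A) (hq : 0 < q) (hn : 0 < n) (h : n + q + 4 = 16 * A * q) :
    ∃ n1 n2 n3 : ℕ, 0 < n1 ∧ 0 < n2 ∧ 0 < n3 ∧
      (4 : ℚ) / n = 1 / n1 + 1 / n2 + 1 / n3 := by
  refine ⟨4 * A * q, 4 * A * n, A * q * n, by positivity, by positivity, by positivity, ?_⟩
  push_cast
  exact four_div_eq_of_add_add_four_eq (by positivity) (by positivity) (by positivity)
    (by exact_mod_cast h)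

theorem erdos_straus_case_I2_eq_4 (r t c m : ℕ) :
    (m = 62 * r + 14 + 2 * c * (48 * r + 11) →
      (4 : ℚ) / (24 * m + 1) =
        1 / (4 * (3 * c + 2) * (48 * r + 11))
        + 1 / (4 * (3 * c + 2) * (24 * (m : ℚ) + 1))
        + 1 / ((3 * c + 2) * (48 * r + 11) * (24 * (m : ℚ) + 1)) ∧
      ∃ n1 n2 n3 : ℕ, 0 < n1 ∧ 0 < n2 ∧ 0 < n3 ∧
        (4 : ℚ) / (24 * m + 1) = 1 / n1 + 1 / n2 + 1 / n3) ∧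
    (m = 94 * r + 84 + 2 * c * (48 * r + 43) →
      (4 : ℚ) / (24 * m + 1) =
        1 / (12 * (c + 1) * (48 * r + 43))
        + 1 / (12 * (c + 1) * (24 * (m : ℚ) + 1))
        + 1 / (3 * (c + 1) * (48 * r + 43) * (24 * (m : ℚ) + 1)) ∧
      ∃ n1 n2 n3 : ℕ, 0 < n1 ∧ 0 < n2 ∧ 0 < n3 ∧
        (4 : ℚ) / (24 * m + 1) = 1 / n1 + 1 / n2 + 1 / n3) ∧
    (m = 94 * t + 37 + 2 * c * (48 * t + 19) →
      (4 : ℚ) / (24 * m + 1) =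
        1 / (12 * (c + 1) * (48 * t + 19))
        + 1 / (12 * (c + 1) * (24 * (m : ℚ) + 1))
        + 1 / (3 * (c + 1) * (48 * t + 19) * (24 * (m : ℚ) + 1)) ∧
      ∃ n1 n2 n3 : ℕ, 0 < n1 ∧ 0 < n2 ∧ 0 < n3 ∧
        (4 : ℚ) / (24 * m + 1) = 1 / n1 + 1 / n2 + 1 / n3) ∧
    (m = 62 * t + 45 + 2 * c * (48 * t + 35) →
      (4 : ℚ) / (24 * m + 1) =
        1 / (4 * (3 * c + 2) * (48 * t + 35))
        + 1 / (4 * (3 * c + 2) * (24 * (m : ℚ) + 1))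
        + 1 / ((3 * c + 2) * (48 * t + 35) * (24 * (m : ℚ) + 1)) ∧
      ∃ n1 n2 n3 : ℕ, 0 < n1 ∧ 0 < n2 ∧ 0 < n3 ∧
        (4 : ℚ) / (24 * m + 1) = 1 / n1 + 1 / n2 + 1 / n3) := by
  refine ⟨fun hm ↦ ⟨?_, ?_⟩, fun hm ↦ ⟨?_, ?_⟩, fun hm ↦ ⟨?_, ?_⟩, fun hm ↦ ⟨?_, ?_⟩⟩
  · exact four_div_eq_of_add_add_four_eq (by positivity) (by positivity) (by positivity)
      (by rw [hm]; push_cast; ring)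
  · exact_mod_cast exists_erdos_straus_of_add_add_four_eq (A := 3 * c + 2) (q := 48 * r + 11)
      (n := 24 * m + 1) (by positivity) (by positivity) (by positivity) (by rw [hm]; ring)
  · convert four_div_eq_of_add_add_four_eq (K := ℚ) (A := 3 * (c + 1)) (q := 48 * r + 43)
      (n := 24 * m + 1) (by positivity) (by positivity) (by positivity)
      (by rw [hm]; push_cast; ring) using 4 <;> ring
  · exact_mod_cast exists_erdos_straus_of_add_add_four_eq (A := 3 * (c + 1)) (q := 48 * r + 43)
      (n := 24 * m + 1) (by positivity) (by positivity) (by positivity) (by rw [hm]; ring)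
  · convert four_div_eq_of_add_add_four_eq (K := ℚ) (A := 3 * (c + 1)) (q := 48 * t + 19)
      (n := 24 * m + 1) (by positivity) (by positivity) (by positivity)
      (by rw [hm]; push_cast; ring) using 4 <;> ring
  · exact_mod_cast exists_erdos_straus_of_add_add_four_eq (A := 3 * (c + 1)) (q := 48 * t + 19)
      (n := 24 * m + 1) (by positivity) (by positivity) (by positivity) (by rw [hm]; ring)
  · exact four_div_eq_of_add_add_four_eq (by positivity) (by positivity) (by positivity)
      (by rw [hm]; push_cast; ring)
  · exact_mod_cast exists_erdos_straus_of_add_add_four_eq (A := 3 * c + 2) (q := 48 * t + 35)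
      (n := 24 * m + 1) (by positivity) (by positivity) (by positivity) (by rw [hm]; ring)
end

section
/- For all s, t, d ∈ ℕ: (a) if m = 3t+2+(5d+4)(4t+3), then 4/(24m+1) = 1/(30(d+1)(4t+3)) + 1/(5(d+1)(24m+1)) + 1/(6(d+1)(4t+3)(24m+1)); (b) if m = s+(5d+3)(4s+1), then 4/(24m+1) = 1/(10(4s+1)(3d+2)) + 1/(5(3d+2)(24m+1)) + 1/(2(4s+1)(3d+2)(24m+1)). In both cases this gives a solution in positive integers of the Erdős–Straus equation for n = 24m+1. -/
/-- The identity `4 * L = N + u + v` splits `4 / N` into three fractions. -/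
theorem four_div_eq_add_add {K : Type*} [Field K] {L N u v : K} (hL : L ≠ 0) (hN : N ≠ 0)
    (h : 4 * L = N + u + v) : 4 / N = 1 / L + u / (L * N) + v / (L * N) := by
  field_simp
  linear_combination h

theorem erdos_straus_case_I2_eq_5 (s t d m : ℕ) :
    (m = 3 * t + 2 + (5 * d + 4) * (4 * t + 3) →
      (4 : ℚ) / (24 * m + 1) =
        1 / (30 * (d + 1) * (4 * t + 3))
        + 1 / (5 * (d + 1) * (24 * (m : ℚ) + 1))
        + 1 / (6 * (d + 1) * (4 * t + 3) * (24 * (m : ℚ) + 1)) ∧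
      ∃ n1 n2 n3 : ℕ, 0 < n1 ∧ 0 < n2 ∧ 0 < n3 ∧
        (4 : ℚ) / (24 * m + 1) = 1 / n1 + 1 / n2 + 1 / n3) ∧
    (m = s + (5 * d + 3) * (4 * s + 1) →
      (4 : ℚ) / (24 * m + 1) =
        1 / (10 * (4 * s + 1) * (3 * d + 2))
        + 1 / (5 * (3 * d + 2) * (24 * (m : ℚ) + 1))
        + 1 / (2 * (4 * s + 1) * (3 * d + 2) * (24 * (m : ℚ) + 1)) ∧
      ∃ n1 n2 n3 : ℕ, 0 < n1 ∧ 0 < n2 ∧ 0 < n3 ∧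
        (4 : ℚ) / (24 * m + 1) = 1 / n1 + 1 / n2 + 1 / n3) := by
  constructor
  · intro hm
    have key : (4 : ℚ) / (24 * m + 1) =
        1 / (30 * (d + 1) * (4 * t + 3))
        + 1 / (5 * (d + 1) * (24 * (m : ℚ) + 1))
        + 1 / (6 * (d + 1) * (4 * t + 3) * (24 * (m : ℚ) + 1)) := by
      have hq : (m : ℚ) = 3 * t + 2 + (5 * d + 4) * (4 * t + 3) := by exact_mod_cast hm
      have hd : (d : ℚ) + 1 ≠ 0 := by positivity
      have ht : 4 * (t : ℚ) + 3 ≠ 0 := by positivity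
      have hN : 24 * (m : ℚ) + 1 ≠ 0 := by positivity
      rw [four_div_eq_add_add (L := 30 * ((d : ℚ) + 1) * (4 * t + 3)) (u := 6 * (4 * t + 3))
        (v := 5) (by positivity) hN (by rw [hq]; ring)]
      congr 1
      · congr 1
        field_simp
        norm_num
      · field_simp
        norm_num
    refine ⟨key, 30 * (d + 1) * (4 * t + 3), 5 * (d + 1) * (24 * m + 1),
      6 * (d + 1) * (4 * t + 3) * (24 * m + 1), by positivity, by positivity, by positivity, ?_⟩
    push_cast
    exact key
  · intro hm
    have key : (4 : ℚ) / (24 * m + 1) =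
        1 / (10 * (4 * s + 1) * (3 * d + 2))
        + 1 / (5 * (3 * d + 2) * (24 * (m : ℚ) + 1))
        + 1 / (2 * (4 * s + 1) * (3 * d + 2) * (24 * (m : ℚ) + 1)) := by
      have hq : (m : ℚ) = s + (5 * d + 3) * (4 * s + 1) := by exact_mod_cast hm
      have hd : 3 * (d : ℚ) + 2 ≠ 0 := by positivity
      have hs : 4 * (s : ℚ) + 1 ≠ 0 := by positivity
      have hN : 24 * (m : ℚ) + 1 ≠ 0 := by positivity
      rw [four_div_eq_add_add (L := 10 * (4 * (s : ℚ) + 1) * (3 * d + 2)) (u := 2 * (4 * s + 1))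
        (v := 5) (by positivity) hN (by rw [hq]; ring)]
      congr 1
      · congr 1
        field_simp
        norm_num
      · field_simp
        norm_num
    refine ⟨key, 10 * (4 * s + 1) * (3 * d + 2), 5 * (3 * d + 2) * (24 * m + 1),
      2 * (4 * s + 1) * (3 * d + 2) * (24 * m + 1), by positivity, by positivity,
      by positivity, ?_⟩
    push_cast
    exact key
end

section
/- For all s, c ∈ ℕ, if m = 23s+16+c(24s+17), then 4/(24m+1) = 1/(6(c+1)(24s+17)) + 1/(6(c+1)(24m+1)) + 1/((c+1)(24s+17)(24m+1)). This gives a solution in positive integers of the Erdős–Straus equation for n = 24m+1. -/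
theorem erdos_straus_case_I2_eq_6 (s c m : ℕ)
    (h : m = 23 * s + 16 + c * (24 * s + 17)) :
    (4 : ℚ) / (24 * m + 1) =
      1 / (6 * (c + 1) * (24 * s + 17))
      + 1 / (6 * (c + 1) * (24 * (m : ℚ) + 1))
      + 1 / ((c + 1) * (24 * s + 17) * (24 * (m : ℚ) + 1)) ∧
    ∃ n1 n2 n3 : ℕ, 0 < n1 ∧ 0 < n2 ∧ 0 < n3 ∧
      (4 : ℚ) / (24 * m + 1) = 1 / n1 + 1 / n2 + 1 / n3 := by
  have key : (4 : ℚ) / (24 * m + 1) =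
      1 / (6 * (c + 1) * (24 * s + 17))
      + 1 / (6 * (c + 1) * (24 * (m : ℚ) + 1))
      + 1 / ((c + 1) * (24 * s + 17) * (24 * (m : ℚ) + 1)) := by
    have hm : (m : ℚ) = 23 * s + 16 + c * (24 * s + 17) := by exact_mod_cast h
    have h1 : (24 * (m : ℚ) + 1) ≠ 0 := by positivity
    have h2 : (24 * (s : ℚ) + 17) ≠ 0 := by positivity
    have h3 : ((c : ℚ) + 1) ≠ 0 := by positivity
    field_simp
    rw [hm]
    ring
  refine ⟨key, 6 * (c + 1) * (24 * s + 17), 6 * (c + 1) * (24 * m + 1),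
    (c + 1) * (24 * s + 17) * (24 * m + 1), by positivity, by positivity, by positivity, ?_⟩
  push_cast
  exact key
end

section
/- For all s, t, d ∈ ℕ, if m = 15t−s+3+(8s+d(12s+1))(24t+5), then m is a positive integer and 4/(24m+1) = 1/(2(3d+2)(12s+1)(24t+5)) + 1/((3d+2)(24t+5)(24m+1)) + 1/(2(3d+2)(12s+1)(24m+1)). This gives a solution in positive integers of the Erdős–Straus equation for n = 24m+1. -/
theorem erdos_straus_case_4_1 (s t d : ℕ) (m : ℤ)
    (h : m = 15 * (t : ℤ) - s + 3 + (8 * s + d * (12 * s + 1)) * (24 * t + 5)) :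
    0 < m ∧
    (4 : ℚ) / (24 * (m : ℚ) + 1) =
      1 / (2 * (3 * (d : ℚ) + 2) * (12 * s + 1) * (24 * t + 5))
      + 1 / ((3 * (d : ℚ) + 2) * (24 * t + 5) * (24 * (m : ℚ) + 1))
      + 1 / (2 * (3 * (d : ℚ) + 2) * (12 * s + 1) * (24 * (m : ℚ) + 1)) ∧
    ∃ n1 n2 n3 : ℕ, 0 < n1 ∧ 0 < n2 ∧ 0 < n3 ∧
      (4 : ℚ) / (24 * (m : ℚ) + 1) = 1 / n1 + 1 / n2 + 1 / n3 := by
  have hm : 0 < m := by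
    have key : m = 15 * (t : ℤ) + 39 * s + 3 + 192 * s * t
        + d * (12 * s + 1) * (24 * t + 5) := by rw [h]; ring
    rw [key]
    positivity
  have hmq : (0 : ℚ) < m := by exact_mod_cast hm
  have hq : (m : ℚ) = 15 * (t : ℚ) - s + 3 + (8 * s + d * (12 * s + 1)) * (24 * t + 5) := by
    exact_mod_cast congrArg (Int.cast : ℤ → ℚ) h
  have hsum : (4 : ℚ) / (24 * (m : ℚ) + 1) =
      1 / (2 * (3 * (d : ℚ) + 2) * (12 * s + 1) * (24 * t + 5))
      + 1 / ((3 * (d : ℚ) + 2) * (24 * t + 5) * (24 * (m : ℚ) + 1))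
      + 1 / (2 * (3 * (d : ℚ) + 2) * (12 * s + 1) * (24 * (m : ℚ) + 1)) := by
    have hn : 24 * (m : ℚ) + 1 ≠ 0 := by positivity
    have hd : 3 * (d : ℚ) + 2 ≠ 0 := by positivity
    have hs : 12 * (s : ℚ) + 1 ≠ 0 := by positivity
    have ht : 24 * (t : ℚ) + 5 ≠ 0 := by positivity
    field_simp
    rw [hq]
    ring
  refine ⟨hm, hsum, ?_⟩
  lift m to ℕ using hm.le
  refine ⟨2 * (3 * d + 2) * (12 * s + 1) * (24 * t + 5),
    (3 * d + 2) * (24 * t + 5) * (24 * m + 1),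
    2 * (3 * d + 2) * (12 * s + 1) * (24 * m + 1),
    by positivity, by positivity, by positivity, ?_⟩
  rw [hsum]
  push_cast
  rfl
end

section
/- For all s, t ∈ ℕ and every positive integer d, if m = −s−t−1+d(12s+1)(8t+7), then m is a positive integer and 4/(24m+1) = 1/(6d(12s+1)(8t+7)) + 1/(3d(8t+7)(24m+1)) + 1/(2d(12s+1)(24m+1)). This gives a solution in positive integers of the Erdős–Straus equation for n = 24m+1. -/
theorem erdos_straus_case_4_3 (s t d : ℕ) (hd : 0 < d) (m : ℤ)
    (h : m = -(s : ℤ) - t - 1 + d * (12 * s + 1) * (8 * t + 7)) :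
    0 < m ∧ 
    (4 : ℚ) / (24 * (m : ℚ) + 1) =
      1 / (6 * (d : ℚ) * (12 * s + 1) * (8 * t + 7))
      + 1 / (3 * (d : ℚ) * (8 * t + 7) * (24 * (m : ℚ) + 1))
      + 1 / (2 * (d : ℚ) * (12 * s + 1) * (24 * (m : ℚ) + 1)) ∧
    ∃ n1 n2 n3 : ℕ, 0 < n1 ∧ 0 < n2 ∧ 0 < n3 ∧
      (4 : ℚ) / (24 * (m : ℚ) + 1) = 1 / n1 + 1 / n2 + 1 / n3 := by
  have hm : 0 < m := by
    have hd1 : (1 : ℤ) ≤ d := by exact_mod_cast hd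
    have hst : (0 : ℤ) ≤ s * t := by positivity
    have hprod : (12 * (s : ℤ) + 1) * (8 * t + 7) ≤ d * ((12 * s + 1) * (8 * t + 7)) :=
      le_mul_of_one_le_left (by positivity) hd1
    rw [h]
    linarith
  have hmQ : (0 : ℚ) < m := by exact_mod_cast hm
  have hdQ : (0 : ℚ) < d := by exact_mod_cast hd
  have key : (4 : ℚ) / (24 * (m : ℚ) + 1) =
      1 / (6 * (d : ℚ) * (12 * s + 1) * (8 * t + 7))
      + 1 / (3 * (d : ℚ) * (8 * t + 7) * (24 * (m : ℚ) + 1))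
      + 1 / (2 * (d : ℚ) * (12 * s + 1) * (24 * (m : ℚ) + 1)) := by
    have hn : (24 * (m : ℚ) + 1) + 2 * (12 * s + 1) + 3 * (8 * t + 7) =
        24 * (d * (12 * s + 1) * (8 * t + 7)) := by
      rw [h]
      push_cast
      ring
    have hA : (12 * (s : ℚ) + 1) ≠ 0 := by positivity
    have hB : (8 * (t : ℚ) + 7) ≠ 0 := by positivity
    have hN : (24 * (m : ℚ) + 1) ≠ 0 := by positivity
    have hD : (d : ℚ) ≠ 0 := hdQ.ne'
    generalize 12 * (s : ℚ) + 1 = A at *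
    generalize 8 * (t : ℚ) + 7 = B at *
    generalize 24 * (m : ℚ) + 1 = N at *
    field_simp
    linarith
  refine ⟨hm, key, ?_⟩
  lift m to ℕ using hm.le
  refine ⟨6 * d * (12 * s + 1) * (8 * t + 7), 3 * d * (8 * t + 7) * (24 * m + 1),
    2 * d * (12 * s + 1) * (24 * m + 1), by positivity, by positivity, by positivity, ?_⟩
  rw [key]
  push_cast
  rfl
end

section
/- For all s, t ∈ ℕ and every positive integer d, if m = −s−t−1+d(12s+5)(24t+13), then m is a positive integer and 4/(24m+1) = 1/(6d(12s+5)(24t+13)) + 1/(3d(24t+13)(24m+1)) + 1/(6d(12s+5)(24m+1)). This gives a solution in positive integers of the Erdős–Straus equation for n = 24m+1. -/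
theorem erdos_straus_case_4_5 (s t d : ℕ) (hd : 0 < d) (m : ℤ)
    (h : m = -(s : ℤ) - t - 1 + d * (12 * s + 5) * (24 * t + 13)) :
    0 < m ∧ 
    (4 : ℚ) / (24 * (m : ℚ) + 1) =
      1 / (6 * (d : ℚ) * (12 * s + 5) * (24 * t + 13))
      + 1 / (3 * (d : ℚ) * (24 * t + 13) * (24 * (m : ℚ) + 1))
      + 1 / (6 * (d : ℚ) * (12 * s + 5) * (24 * (m : ℚ) + 1)) ∧
    ∃ n1 n2 n3 : ℕ, 0 < n1 ∧ 0 < n2 ∧ 0 < n3 ∧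
      (4 : ℚ) / (24 * (m : ℚ) + 1) = 1 / n1 + 1 / n2 + 1 / n3 := by
  have hm : 0 < m := by
    have hd' : (1 : ℤ) ≤ d := by exact_mod_cast hd
    have hs : (0 : ℤ) ≤ s := by positivity
    have ht : (0 : ℤ) ≤ t := by positivity
    have hprod : (0 : ℤ) ≤ (d - 1) * ((12 * s + 5) * (24 * t + 13)) :=
      mul_nonneg (by linarith) (by positivity)
    nlinarith [mul_nonneg hs ht]
  have key : (4 : ℚ) / (24 * (m : ℚ) + 1) =
      1 / (6 * (d : ℚ) * (12 * s + 5) * (24 * t + 13))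
      + 1 / (3 * (d : ℚ) * (24 * t + 13) * (24 * (m : ℚ) + 1))
      + 1 / (6 * (d : ℚ) * (12 * s + 5) * (24 * (m : ℚ) + 1)) := by
    have hmq : (m : ℚ) = -(s : ℚ) - t - 1 + d * (12 * s + 5) * (24 * t + 13) := by
      exact_mod_cast h
    have hdq : (d : ℚ) ≠ 0 := by positivity
    have hs : (12 * s + 5 : ℚ) ≠ 0 := by positivity
    have ht : (24 * t + 13 : ℚ) ≠ 0 := by positivity
    have hn : (24 * m + 1 : ℚ) ≠ 0 := by
      have : (0 : ℚ) < m := by exact_mod_cast hm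
      positivity
    field_simp
    linear_combination -72 * hmq
  refine ⟨hm, key, ?_⟩
  lift m to ℕ using hm.le
  refine ⟨6 * d * (12 * s + 5) * (24 * t + 13), 3 * d * (24 * t + 13) * (24 * m + 1),
    6 * d * (12 * s + 5) * (24 * m + 1), by positivity, by positivity, by positivity, ?_⟩
  push_cast at key ⊢
  exact key
end

section
/- For all s, t ∈ ℕ and every positive integer d, if m = −s−t−1+d(12s+7)(8t+3), then m is a positive integer and 4/(24m+1) = 1/(6d(12s+7)(8t+3)) + 1/(3d(8t+3)(24m+1)) + 1/(2d(12s+7)(24m+1)). This gives a solution in positive integers of the Erdős–Straus equation for n = 24m+1. -/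
theorem erdos_straus_case_4_7 (s t d : ℕ) (hd : 0 < d) (m : ℤ)
    (h : m = -(s : ℤ) - t - 1 + d * (12 * s + 7) * (8 * t + 3)) :
    0 < m ∧ 
    (4 : ℚ) / (24 * (m : ℚ) + 1) =
      1 / (6 * (d : ℚ) * (12 * s + 7) * (8 * t + 3))
      + 1 / (3 * (d : ℚ) * (8 * t + 3) * (24 * (m : ℚ) + 1))
      + 1 / (2 * (d : ℚ) * (12 * s + 7) * (24 * (m : ℚ) + 1)) ∧
    ∃ n1 n2 n3 : ℕ, 0 < n1 ∧ 0 < n2 ∧ 0 < n3 ∧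
      (4 : ℚ) / (24 * (m : ℚ) + 1) = 1 / n1 + 1 / n2 + 1 / n3 := by
  have hm : 0 < m := by
    have h1 : (1 : ℤ) ≤ d := by exact_mod_cast hd
    have h2 : (0 : ℤ) ≤ (12 * s + 7) * (8 * t + 3) := by positivity
    have h3 := mul_le_mul_of_nonneg_right h1 h2
    have h4 : (0 : ℤ) ≤ s * t := by positivity
    have hs : (0 : ℤ) ≤ s := by positivity
    have ht : (0 : ℤ) ≤ t := by positivity
    rw [h]
    linarith
  have hmq : (0 : ℚ) < m := by exact_mod_cast hm
  have hdq : (0 : ℚ) < d := by exact_mod_cast hd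
  have hq : (m : ℚ) = -(s : ℚ) - t - 1 + d * (12 * s + 7) * (8 * t + 3) := by
    exact_mod_cast h
  have key : (4 : ℚ) / (24 * (m : ℚ) + 1) =
      1 / (6 * (d : ℚ) * (12 * s + 7) * (8 * t + 3))
      + 1 / (3 * (d : ℚ) * (8 * t + 3) * (24 * (m : ℚ) + 1))
      + 1 / (2 * (d : ℚ) * (12 * s + 7) * (24 * (m : ℚ) + 1)) := by
    have hn : (24 * (m : ℚ) + 1) ≠ 0 := by positivity
    have hA : (12 * (s : ℚ) + 7) ≠ 0 := by positivity
    have hB : (8 * (t : ℚ) + 3) ≠ 0 := by positivity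
    have hsum : 1 / (6 * (d : ℚ) * (12 * s + 7) * (8 * t + 3))
        + 1 / (3 * (d : ℚ) * (8 * t + 3) * (24 * (m : ℚ) + 1))
        + 1 / (2 * (d : ℚ) * (12 * s + 7) * (24 * (m : ℚ) + 1))
        = ((24 * (m : ℚ) + 1) + 2 * (12 * s + 7) + 3 * (8 * t + 3)) /
          (6 * d * (12 * s + 7) * (8 * t + 3) * (24 * (m : ℚ) + 1)) := by
      generalize 24 * (m : ℚ) + 1 = n at *
      generalize 12 * (s : ℚ) + 7 = a at *
      generalize 8 * (t : ℚ) + 3 = b at *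
      field_simp
      ring
    rw [hsum, div_eq_div_iff hn (by positivity)]
    linear_combination (-24 * (24 * (m : ℚ) + 1)) * hq
  refine ⟨hm, key, ?_⟩
  lift m to ℕ using hm.le
  refine ⟨6 * d * (12 * s + 7) * (8 * t + 3), 3 * d * (8 * t + 3) * (24 * m + 1),
    2 * d * (12 * s + 7) * (24 * m + 1), by positivity, by positivity, by positivity, ?_⟩
  rw [key]
  push_cast
  rfl
end

section
/- For all s, t ∈ ℕ and every positive integer d, if m = −s−t−1+d(12s+11)(24t+1), then m is a positive integer and 4/(24m+1) = 1/(6d(12s+11)(24t+1)) + 1/(3d(24t+1)(24m+1)) + 1/(6d(12s+11)(24m+1)). This gives a solution in positive integers of the Erdős–Straus equation for n = 24m+1. -/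
theorem erdos_straus_case_4_9 (s t d : ℕ) (hd : 0 < d) (m : ℤ)
    (h : m = -(s : ℤ) - t - 1 + d * (12 * s + 11) * (24 * t + 1)) :
    0 < m ∧ 
    (4 : ℚ) / (24 * (m : ℚ) + 1) =
      1 / (6 * (d : ℚ) * (12 * s + 11) * (24 * t + 1))
      + 1 / (3 * (d : ℚ) * (24 * t + 1) * (24 * (m : ℚ) + 1))
      + 1 / (6 * (d : ℚ) * (12 * s + 11) * (24 * (m : ℚ) + 1)) ∧
    ∃ n1 n2 n3 : ℕ, 0 < n1 ∧ 0 < n2 ∧ 0 < n3 ∧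
      (4 : ℚ) / (24 * (m : ℚ) + 1) = 1 / n1 + 1 / n2 + 1 / n3 := by
  have hm : 0 < m := by
    have hd1 : (1 : ℤ) ≤ d := by exact_mod_cast hd
    have hst : (0 : ℤ) ≤ s * t := by positivity
    have hAB : (0 : ℤ) ≤ (12 * s + 11) * (24 * t + 1) := by positivity
    have hle := mul_le_mul_of_nonneg_right hd1 hAB
    nlinarith
  have key : (4 : ℚ) / (24 * (m : ℚ) + 1) =
      1 / (6 * (d : ℚ) * (12 * s + 11) * (24 * t + 1))
      + 1 / (3 * (d : ℚ) * (24 * t + 1) * (24 * (m : ℚ) + 1))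
      + 1 / (6 * (d : ℚ) * (12 * s + 11) * (24 * (m : ℚ) + 1)) := by
    have hq : (m : ℚ) = -(s : ℚ) - t - 1 + d * (12 * s + 11) * (24 * t + 1) := by
      exact_mod_cast congrArg (Int.cast : ℤ → ℚ) h
    have hmq : (0 : ℚ) < m := by exact_mod_cast hm
    have hN : (24 * (m : ℚ) + 1) ≠ 0 := by positivity
    have hA : (12 * (s : ℚ) + 11) ≠ 0 := by positivity
    have hB : (24 * (t : ℚ) + 1) ≠ 0 := by positivity
    have hD : (d : ℚ) ≠ 0 := by positivity
    field_simp
    linear_combination -72 * hq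
  refine ⟨hm, key, ?_⟩
  lift m to ℕ using hm.le
  refine ⟨6 * d * (12 * s + 11) * (24 * t + 1), 3 * d * (24 * t + 1) * (24 * m + 1),
    6 * d * (12 * s + 11) * (24 * m + 1), by positivity, by positivity, by positivity, ?_⟩
  push_cast at key ⊢
  exact key
end

section
/- For all r, t ∈ ℕ and every positive integer d, if m = 2(−r−t−1+d(12r+1)(48t+43)), then m is a positive even integer and 4/(24m+1) = 1/(12d(12r+1)(48t+43)) + 1/(3d(48t+43)(24m+1)) + 1/(12d(12r+1)(24m+1)). This gives a solution in positive integers of the Erdős–Straus equation for n = 24m+1. -/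
theorem erdos_straus_case_5_2 (r t d : ℕ) (hd : 0 < d) (m : ℤ)
    (h : m = 2 * (-(r : ℤ) - t - 1 + d * (12 * r + 1) * (48 * t + 43))) :
    0 < m ∧ Even m ∧
    (4 : ℚ) / (24 * (m : ℚ) + 1) =
      1 / (12 * (d : ℚ) * (12 * (r : ℚ) + 1) * (48 * t + 43))
      + 1 / (3 * (d : ℚ) * (48 * (t : ℚ) + 43) * (24 * (m : ℚ) + 1))
      + 1 / (12 * (d : ℚ) * (12 * (r : ℚ) + 1) * (24 * (m : ℚ) + 1)) ∧
    ∃ n1 n2 n3 : ℕ, 0 < n1 ∧ 0 < n2 ∧ 0 < n3 ∧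
      (4 : ℚ) / (24 * (m : ℚ) + 1) = 1 / n1 + 1 / n2 + 1 / n3 := by
  have hm : 0 < m := by
    have hd' : (1 : ℤ) ≤ d := by exact_mod_cast hd
    have hr : (0 : ℤ) ≤ r := by positivity
    have ht : (0 : ℤ) ≤ t := by positivity
    have hprod : (12 * r + 1) * (48 * t + 43) ≤ (d : ℤ) * ((12 * r + 1) * (48 * t + 43)) :=
      le_mul_of_one_le_left (by positivity) hd'
    nlinarith [mul_nonneg hr ht]
  have identity : (4 : ℚ) / (24 * (m : ℚ) + 1) =
      1 / (12 * (d : ℚ) * (12 * (r : ℚ) + 1) * (48 * t + 43))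
      + 1 / (3 * (d : ℚ) * (48 * (t : ℚ) + 43) * (24 * (m : ℚ) + 1))
      + 1 / (12 * (d : ℚ) * (12 * (r : ℚ) + 1) * (24 * (m : ℚ) + 1)) := by
    have hmQ : (0 : ℚ) < m := by exact_mod_cast hm
    have hN : 24 * (m : ℚ) + 1 ≠ 0 := by positivity
    have hA : 12 * (r : ℚ) + 1 ≠ 0 := by positivity
    have hB : 48 * (t : ℚ) + 43 ≠ 0 := by positivity
    have hdQ : (d : ℚ) ≠ 0 := by positivity
    have hQ : (m : ℚ) = 2 * (-(r : ℚ) - t - 1 + d * (12 * r + 1) * (48 * t + 43)) := by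
      exact_mod_cast h
    have key : 48 * (d : ℚ) * (12 * r + 1) * (48 * t + 43) =
        (24 * m + 1) + 4 * (12 * r + 1) + (48 * t + 43) := by
      rw [hQ]; ring
    generalize 24 * (m : ℚ) + 1 = N at *
    generalize 12 * (r : ℚ) + 1 = A at *
    generalize 48 * (t : ℚ) + 43 = B at *
    field_simp
    linear_combination 3 * key
  refine ⟨hm, h ▸ even_two_mul _, identity, ?_⟩
  lift m to ℕ using hm.le
  have hm' : 0 < m := by exact_mod_cast hm
  refine ⟨12 * d * (12 * r + 1) * (48 * t + 43), 3 * d * (48 * t + 43) * (24 * m + 1),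
    12 * d * (12 * r + 1) * (24 * m + 1), by positivity, by positivity, by positivity, ?_⟩
  rw [identity]
  push_cast
  rfl
end

section
/- For all r, t ∈ ℕ and every positive integer d, if m = 2(−r−t−1+d(12r+7)(48t+19)), then m is a positive even integer and 4/(24m+1) = 1/(12d(12r+7)(48t+19)) + 1/(3d(48t+19)(24m+1)) + 1/(12d(12r+7)(24m+1)). This gives a solution in positive integers of the Erdős–Straus equation for n = 24m+1. -/
theorem erdos_straus_case_5_4 (r t d : ℕ) (hd : 0 < d) (m : ℤ)
    (h : m = 2 * (-(r : ℤ) - t - 1 + d * (12 * r + 7) * (48 * t + 19))) :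
    0 < m ∧ Even m ∧
    (4 : ℚ) / (24 * (m : ℚ) + 1) =
      1 / (12 * (d : ℚ) * (12 * (r : ℚ) + 7) * (48 * t + 19))
      + 1 / (3 * (d : ℚ) * (48 * (t : ℚ) + 19) * (24 * (m : ℚ) + 1))
      + 1 / (12 * (d : ℚ) * (12 * (r : ℚ) + 7) * (24 * (m : ℚ) + 1)) ∧
    ∃ n1 n2 n3 : ℕ, 0 < n1 ∧ 0 < n2 ∧ 0 < n3 ∧
      (4 : ℚ) / (24 * (m : ℚ) + 1) = 1 / n1 + 1 / n2 + 1 / n3 := by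
  have hm : 0 < m := by
    have hd' : (1 : ℤ) ≤ d := by exact_mod_cast hd
    have hr : (0 : ℤ) ≤ r := by positivity
    have ht : (0 : ℤ) ≤ t := by positivity
    have h₁ : (12 * (r : ℤ) + 7) * (48 * t + 19) ≤ d * ((12 * r + 7) * (48 * t + 19)) :=
      le_mul_of_one_le_left (by positivity) hd'
    nlinarith [mul_nonneg hr ht]
  have hmQ : (0 : ℚ) < m := by exact_mod_cast hm
  have hdQ : (0 : ℚ) < d := by exact_mod_cast hd
  have key : 24 * (m : ℚ) + 1 + 4 * (12 * r + 7) + (48 * t + 19) =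
      48 * (d * (12 * r + 7) * (48 * t + 19)) := by
    rw [h]
    push_cast
    ring
  have identity : (4 : ℚ) / (24 * (m : ℚ) + 1) =
      1 / (12 * (d : ℚ) * (12 * (r : ℚ) + 7) * (48 * t + 19))
      + 1 / (3 * (d : ℚ) * (48 * (t : ℚ) + 19) * (24 * (m : ℚ) + 1))
      + 1 / (12 * (d : ℚ) * (12 * (r : ℚ) + 7) * (24 * (m : ℚ) + 1)) := by
    have hA : (0 : ℚ) < 12 * r + 7 := by positivity
    have hB : (0 : ℚ) < 48 * t + 19 := by positivity
    have hn : (0 : ℚ) < 24 * m + 1 := by positivity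
    generalize (12 * (r : ℚ) + 7) = A at *
    generalize (48 * (t : ℚ) + 19) = B at *
    generalize (24 * (m : ℚ) + 1) = n at *
    field_simp
    linarith
  refine ⟨hm, h ▸ even_two_mul _, identity, ?_⟩
  have hcast : ((m.toNat : ℕ) : ℚ) = m := by
    exact_mod_cast congrArg (Int.cast : ℤ → ℚ) (Int.toNat_of_nonneg hm.le)
  refine ⟨12 * d * (12 * r + 7) * (48 * t + 19),
    3 * d * (48 * t + 19) * (24 * m.toNat + 1),
    12 * d * (12 * r + 7) * (24 * m.toNat + 1),
    by positivity, by positivity, by positivity, ?_⟩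
  push_cast [hcast]
  exact identity
end

section
/- For all r, t ∈ ℕ and every positive integer d, if m = 2(−r−t+d(12r+1)(48t+19))−1, then m is a positive odd integer and 4/(24m+1) = 1/(12d(12r+1)(48t+19)) + 1/(3d(48t+19)(24m+1)) + 1/(12d(12r+1)(24m+1)). This gives a solution in positive integers of the Erdős–Straus equation for n = 24m+1. -/
theorem erdos_straus_case_5_7 (r t d : ℕ) (hd : 0 < d) (m : ℤ)
    (h : m = 2 * (-(r : ℤ) - t + d * (12 * r + 1) * (48 * t + 19)) - 1) :
    0 < m ∧ Odd m ∧
    (4 : ℚ) / (24 * (m : ℚ) + 1) =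
      1 / (12 * (d : ℚ) * (12 * (r : ℚ) + 1) * (48 * t + 19))
      + 1 / (3 * (d : ℚ) * (48 * (t : ℚ) + 19) * (24 * (m : ℚ) + 1))
      + 1 / (12 * (d : ℚ) * (12 * (r : ℚ) + 1) * (24 * (m : ℚ) + 1)) ∧
    ∃ n1 n2 n3 : ℕ, 0 < n1 ∧ 0 < n2 ∧ 0 < n3 ∧
      (4 : ℚ) / (24 * (m : ℚ) + 1) = 1 / n1 + 1 / n2 + 1 / n3 := by
  have hpos : 0 < m := by
    have hd' : (1 : ℤ) ≤ d := by exact_mod_cast hd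
    have hr : (0 : ℤ) ≤ r := by positivity
    have ht : (0 : ℤ) ≤ t := by positivity
    have hmul : (12 * r + 1) * (48 * t + 19) ≤ (d : ℤ) * ((12 * r + 1) * (48 * t + 19)) :=
      le_mul_of_one_le_left (by positivity) hd'
    have hrt : (0 : ℤ) ≤ r * t := by positivity
    linarith
  have hodd : Odd m := ⟨-(r : ℤ) - t + d * (12 * r + 1) * (48 * t + 19) - 1, by rw [h]; ring⟩
  have hsum : (4 : ℚ) / (24 * (m : ℚ) + 1) =
      1 / (12 * (d : ℚ) * (12 * (r : ℚ) + 1) * (48 * t + 19))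
      + 1 / (3 * (d : ℚ) * (48 * (t : ℚ) + 19) * (24 * (m : ℚ) + 1))
      + 1 / (12 * (d : ℚ) * (12 * (r : ℚ) + 1) * (24 * (m : ℚ) + 1)) := by
    have hm : (0 : ℚ) < m := by exact_mod_cast hpos
    have hN : 24 * (m : ℚ) + 1 =
        48 * d * (12 * r + 1) * (48 * t + 19) - 4 * (12 * r + 1) - (48 * t + 19) := by
      rw [h]; push_cast; ring
    have hN0 : 24 * (m : ℚ) + 1 ≠ 0 := by positivity
    have hd0 : (d : ℚ) ≠ 0 := by positivity
    have hA0 : 12 * (r : ℚ) + 1 ≠ 0 := by positivity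
    have hB0 : 48 * (t : ℚ) + 19 ≠ 0 := by positivity
    generalize 24 * (m : ℚ) + 1 = N at *
    generalize 12 * (r : ℚ) + 1 = A at *
    generalize 48 * (t : ℚ) + 19 = B at *
    field_simp
    linear_combination -3 * hN
  refine ⟨hpos, hodd, hsum, ?_⟩
  lift m to ℕ using hpos.le
  refine ⟨12 * d * (12 * r + 1) * (48 * t + 19), 3 * d * (48 * t + 19) * (24 * m + 1),
    12 * d * (12 * r + 1) * (24 * m + 1), by positivity, by positivity, by positivity, ?_⟩
  rw [hsum]
  push_cast
  rfl
end

section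
/- For every integer ι ≥ 1 and every c ∈ ℕ, if m = 2(4^ι − 1)/3 + (19+20c)·4^ι, then m is a positive integer and 4/(24m+1) = 1/(15(c+1)·2^{2ι+3}) + 1/(15(c+1)(24m+1)) + 1/((c+1)·2^{2ι+3}·(24m+1)). This gives a solution in positive integers of the Erdős–Straus equation for n = 24m+1. -/
theorem erdos_straus_pow2_case_6_1 (ι c m : ℕ) (hι : 1 ≤ ι)
    (h : m = 2 * (4 ^ ι - 1) / 3 + (19 + 20 * c) * 4 ^ ι) :
    0 < m ∧
    (4 : ℚ) / (24 * (m : ℚ) + 1) =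
      1 / (15 * ((c : ℚ) + 1) * 2 ^ (2 * ι + 3))
      + 1 / (15 * ((c : ℚ) + 1) * (24 * (m : ℚ) + 1))
      + 1 / (((c : ℚ) + 1) * 2 ^ (2 * ι + 3) * (24 * (m : ℚ) + 1)) ∧
    ∃ n1 n2 n3 : ℕ, 0 < n1 ∧ 0 < n2 ∧ 0 < n3 ∧
      (4 : ℚ) / (24 * (m : ℚ) + 1) = 1 / n1 + 1 / n2 + 1 / n3 := by
  have hm : 3 * m + 2 = (59 + 60 * c) * 4 ^ ι := by
    have hdvd : 3 ∣ 4 ^ ι - 1 := by simpa using Nat.sub_dvd_pow_sub_pow 4 1 ι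
    have hpos : 0 < 4 ^ ι := by positivity
    obtain ⟨k, hk⟩ := hdvd
    have hpow : 4 ^ ι = 3 * k + 1 := by omega
    have hdiv : 2 * (3 * k) / 3 = 2 * k := by omega
    rw [hk, hdiv, hpow] at h
    rw [h, hpow]
    ring
  have hm0 : 0 < m := by
    rw [h]
    positivity
  have hn : 24 * (m : ℚ) + 1 = (59 + 60 * c) * 2 ^ (2 * ι + 3) - 15 := by
    have hmq : 3 * (m : ℚ) + 2 = (59 + 60 * c) * 4 ^ ι := by exact_mod_cast hm
    have hpow : (2 : ℚ) ^ (2 * ι + 3) = 8 * 4 ^ ι := by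
      rw [pow_add, pow_mul]
      norm_num [mul_comm]
    rw [hpow]
    linear_combination 8 * hmq
  have key : (4 : ℚ) / (24 * (m : ℚ) + 1) =
      1 / (15 * ((c : ℚ) + 1) * 2 ^ (2 * ι + 3))
      + 1 / (15 * ((c : ℚ) + 1) * (24 * (m : ℚ) + 1))
      + 1 / (((c : ℚ) + 1) * 2 ^ (2 * ι + 3) * (24 * (m : ℚ) + 1)) := by
    have hn0 : 24 * (m : ℚ) + 1 ≠ 0 := by positivity
    have hc0 : (c : ℚ) + 1 ≠ 0 := by positivity
    have hP0 : (2 : ℚ) ^ (2 * ι + 3) ≠ 0 := by positivity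
    generalize (2 : ℚ) ^ (2 * ι + 3) = P at *
    generalize 24 * (m : ℚ) + 1 = n at *
    field_simp
    linear_combination -hn
  refine ⟨hm0, key, 15 * (c + 1) * 2 ^ (2 * ι + 3), 15 * (c + 1) * (24 * m + 1),
    (c + 1) * 2 ^ (2 * ι + 3) * (24 * m + 1), by positivity, by positivity, by positivity, ?_⟩
  push_cast
  exact key
end

section
/- For every integer r ≥ 1 and every c ∈ ℕ, if m = 2^{r−1} − 2 + (31+47c)·2^{r+1}, then m is a positive integer and 4/(24m+1) = 1/(47(3c+2)·2^{r+2}) + 1/(47(3c+2)(24m+1)) + 1/((3c+2)·2^{r+2}·(24m+1)). This gives a solution in positive integers of the Erdős–Straus equation for n = 24m+1. -/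
theorem erdos_straus_pow2_case_6_2 (r c : ℕ) (hr : 1 ≤ r) (m : ℤ)
    (h : m = 2 ^ (r - 1) - 2 + (31 + 47 * (c : ℤ)) * 2 ^ (r + 1)) :
    0 < m ∧
    (4 : ℚ) / (24 * (m : ℚ) + 1) =
      1 / (47 * (3 * (c : ℚ) + 2) * 2 ^ (r + 2))
      + 1 / (47 * (3 * (c : ℚ) + 2) * (24 * (m : ℚ) + 1))
      + 1 / ((3 * (c : ℚ) + 2) * 2 ^ (r + 2) * (24 * (m : ℚ) + 1)) ∧
    ∃ n1 n2 n3 : ℕ, 0 < n1 ∧ 0 < n2 ∧ 0 < n3 ∧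
      (4 : ℚ) / (24 * (m : ℚ) + 1) = 1 / n1 + 1 / n2 + 1 / n3 := by
  obtain ⟨s, rfl⟩ := Nat.exists_eq_add_of_le' hr
  rw [Nat.add_sub_cancel] at h
  have hm : 0 < m := by
    have hs : (1 : ℤ) ≤ 2 ^ s := one_le_pow₀ (by norm_num)
    have hcs : 0 ≤ (c : ℤ) * 2 ^ s := by positivity
    have hexp : m = 125 * 2 ^ s - 2 + 188 * ((c : ℤ) * 2 ^ s) := by rw [h]; ring
    linarith
  have hn : 24 * (m : ℚ) + 1 = 1504 * (3 * (c : ℚ) + 2) * 2 ^ s - 8 * 2 ^ s - 47 := by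
    rw [h]
    push_cast
    ring
  have hn0 : 24 * (m : ℚ) + 1 ≠ 0 := by positivity
  have hc0 : 3 * (c : ℚ) + 2 ≠ 0 := by positivity
  have hs0 : (2 : ℚ) ^ s ≠ 0 := by positivity
  have key : (4 : ℚ) / (24 * (m : ℚ) + 1) =
      1 / (47 * (3 * (c : ℚ) + 2) * 2 ^ (s + 1 + 2))
      + 1 / (47 * (3 * (c : ℚ) + 2) * (24 * (m : ℚ) + 1))
      + 1 / ((3 * (c : ℚ) + 2) * 2 ^ (s + 1 + 2) * (24 * (m : ℚ) + 1)) := by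
    have hpow : (2 : ℚ) ^ (s + 1 + 2) = 8 * 2 ^ s := by ring
    rw [hpow]
    generalize 24 * (m : ℚ) + 1 = n at *
    generalize 3 * (c : ℚ) + 2 = a at *
    generalize (2 : ℚ) ^ s = p at *
    field_simp
    linarith
  refine ⟨hm, key, ?_⟩
  lift m to ℕ using hm.le
  refine ⟨47 * (3 * c + 2) * 2 ^ (s + 1 + 2), 47 * (3 * c + 2) * (24 * m + 1),
    (3 * c + 2) * 2 ^ (s + 1 + 2) * (24 * m + 1), by positivity, by positivity,
    by positivity, ?_⟩
  rw [key]
  push_cast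
  rfl
end

section
/- Let r ≥ 1 be an integer and let a, c ∈ ℕ satisfy 3(a+1) = 2c(2^{r+3} − 1). If m = 2^{r−1} + a·2^r, then 4/(24m+1) = 1/(c(2^{r+3}−1)·2^{r+2}) + 1/(c(2^{r+3}−1)(24m+1)) + 1/(2^{r+2}·c·(24m+1)). This gives a solution in positive integers of the Erdős–Straus equation for n = 24m+1. -/
theorem erdos_straus_pow2_case_6_3 (r a c m : ℕ) (hr : 1 ≤ r)
    (hac : 3 * (a + 1) = 2 * c * (2 ^ (r + 3) - 1))
    (h : m = 2 ^ (r - 1) + a * 2 ^ r) :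
    (4 : ℚ) / (24 * (m : ℚ) + 1) =
      1 / ((c : ℚ) * (2 ^ (r + 3) - 1) * 2 ^ (r + 2))
      + 1 / ((c : ℚ) * (2 ^ (r + 3) - 1) * (24 * (m : ℚ) + 1))
      + 1 / (2 ^ (r + 2) * (c : ℚ) * (24 * (m : ℚ) + 1)) ∧
    ∃ n1 n2 n3 : ℕ, 0 < n1 ∧ 0 < n2 ∧ 0 < n3 ∧
      (4 : ℚ) / (24 * (m : ℚ) + 1) = 1 / n1 + 1 / n2 + 1 / n3 := by
  obtain ⟨s, rfl⟩ : ∃ s, r = s + 1 := ⟨r - 1, by omega⟩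
  have hu : 0 < 2 ^ s := by positivity
  have hK : 2 ^ (s + 1 + 3) - 1 + 1 = 16 * 2 ^ s := by rw [pow_add, pow_add]; omega
  have hKQ : (2 : ℚ) ^ (s + 1 + 3) - 1 = ((2 ^ (s + 1 + 3) - 1 : ℕ) : ℚ) := by
    rw [Nat.cast_sub Nat.one_le_two_pow]; push_cast; rfl
  have hPQ : (2 : ℚ) ^ (s + 1 + 2) = 8 * ((2 ^ s : ℕ) : ℚ) := by push_cast; ring
  have hm : m = 2 ^ s + a * (2 * 2 ^ s) := by rw [h, Nat.add_sub_cancel]; ring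
  rw [hKQ, hPQ]
  generalize 2 ^ (s + 1 + 3) - 1 = K at *
  generalize 2 ^ s = u at *
  have hc : 0 < c := by
    rcases Nat.eq_zero_or_pos c with rfl | hc
    · simp at hac
    · exact hc
  have hK0 : 0 < K := by omega
  have hn : 24 * m + 1 + 8 * u + K = 4 * (c * K * (8 * u)) := by
    subst hm
    linear_combination hK + 16 * u * hac
  have hnQ : (24 * (m : ℚ) + 1) + 8 * u + K = 4 * (c * K * (8 * u)) := by exact_mod_cast hn
  have key : (4 : ℚ) / (24 * (m : ℚ) + 1) =
      1 / ((c : ℚ) * K * (8 * u)) + 1 / ((c : ℚ) * K * (24 * (m : ℚ) + 1))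
      + 1 / (8 * u * (c : ℚ) * (24 * (m : ℚ) + 1)) := by
    have : (c : ℚ) ≠ 0 := by positivity
    have : (K : ℚ) ≠ 0 := by positivity
    have : (u : ℚ) ≠ 0 := by positivity
    have : 24 * (m : ℚ) + 1 ≠ 0 := by positivity
    field_simp
    linear_combination -hnQ
  refine ⟨key, c * K * (8 * u), c * K * (24 * m + 1), 8 * u * c * (24 * m + 1),
    by positivity, by positivity, by positivity, ?_⟩
  rw [key]
  push_cast
  rfl
end

section
/- Let r ≥ 1 be an integer and let a, c ∈ ℕ satisfy 3a = c(2^{r+4} − 1) − 1. If m = 2^{r−1} + a·2^{r+2}, then 4/(24m+1) = 1/(c(2^{r+4}−1)·2^{r+3}) + 1/(2c(2^{r+4}−1)(24m+1)) + 1/(2^{r+3}·c·(24m+1)). This gives a solution in positive integers of the Erdős–Straus equation for n = 24m+1. -/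
theorem erdos_straus_pow2_case_6_4 (r a c m : ℕ) (hr : 1 ≤ r)
    (hac : 3 * (a : ℤ) = c * (2 ^ (r + 4) - 1) - 1)
    (h : m = 2 ^ (r - 1) + a * 2 ^ (r + 2)) :
    (4 : ℚ) / (24 * (m : ℚ) + 1) =
      1 / ((c : ℚ) * (2 ^ (r + 4) - 1) * 2 ^ (r + 3))
      + 1 / (2 * (c : ℚ) * (2 ^ (r + 4) - 1) * (24 * (m : ℚ) + 1))
      + 1 / (2 ^ (r + 3) * (c : ℚ) * (24 * (m : ℚ) + 1)) ∧
    ∃ n1 n2 n3 : ℕ, 0 < n1 ∧ 0 < n2 ∧ 0 < n3 ∧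
      (4 : ℚ) / (24 * (m : ℚ) + 1) = 1 / n1 + 1 / n2 + 1 / n3 := by
  obtain ⟨s, rfl⟩ : ∃ s, r = s + 1 := ⟨r - 1, by omega⟩
  have hc : 0 < c := by
    rcases Nat.eq_zero_or_pos c with rfl | hc
    · push_cast at hac
      omega
    · exact hc
  have hP : 1 ≤ 2 ^ s := Nat.one_le_two_pow
  have hac' : 3 * (a : ℚ) = c * (2 ^ (s + 1 + 4) - 1) - 1 := by exact_mod_cast hac
  have hK : (0 : ℚ) < 2 ^ (s + 1 + 4) - 1 := by
    have hP' : (1 : ℚ) ≤ 2 ^ s := by exact_mod_cast hP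
    rw [pow_add, pow_add]
    linarith
  have hcQ : (0 : ℚ) < c := by exact_mod_cast hc
  have hN : (0 : ℚ) < 24 * (m : ℚ) + 1 := by positivity
  have hsum : 24 * (m : ℚ) + 1 + 2 ^ (s + 3) + (2 ^ (s + 1 + 4) - 1) =
      4 * (2 ^ (s + 1 + 3) * c * (2 ^ (s + 1 + 4) - 1)) := by
    have hm : (m : ℚ) = 2 ^ s + a * 2 ^ (s + 1 + 2) := by
      rw [h]
      push_cast
      rfl
    rw [hm]
    linear_combination 64 * 2 ^ s * hac'
  have identity : (4 : ℚ) / (24 * (m : ℚ) + 1) =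
      1 / ((c : ℚ) * (2 ^ (s + 1 + 4) - 1) * 2 ^ (s + 1 + 3))
      + 1 / (2 * (c : ℚ) * (2 ^ (s + 1 + 4) - 1) * (24 * (m : ℚ) + 1))
      + 1 / (2 ^ (s + 1 + 3) * (c : ℚ) * (24 * (m : ℚ) + 1)) := by
    have hQ : (2 : ℚ) ^ (s + 1 + 3) = 2 * 2 ^ (s + 3) := by ring
    rw [hQ] at hsum ⊢
    have hQpos : (0 : ℚ) < 2 ^ (s + 3) := by positivity
    generalize (2 : ℚ) ^ (s + 1 + 4) - 1 = K at *
    generalize (2 : ℚ) ^ (s + 3) = Q at *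
    generalize 24 * (m : ℚ) + 1 = N at *
    field_simp
    linear_combination -hsum
  have hKN : 0 < 2 ^ (s + 1 + 4) - 1 := by
    rw [pow_add, pow_add]
    omega
  refine ⟨identity, c * (2 ^ (s + 1 + 4) - 1) * 2 ^ (s + 1 + 3),
    2 * c * (2 ^ (s + 1 + 4) - 1) * (24 * m + 1), 2 ^ (s + 1 + 3) * c * (24 * m + 1),
    by positivity, by positivity, by positivity, ?_⟩
  rw [identity]
  push_cast [Nat.cast_sub (Nat.one_le_two_pow : 1 ≤ 2 ^ (s + 1 + 4))]
  rfl
end
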